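/- Let ι : P → O₀ be the ℂ-algebra homomorphism sending a polynomial p to the germ at 0 of its evaluation function on ℂⁿ. For an ideal Ĩ of P, the following are equivalent: (a) there exists k ∈ ℕ with m^(k+1) ⊆ Ĩ; (b) there exists a cofinite ideal I of O₀ with Ĩ = ι⁻¹(I). Moreover, if these conditions hold, then the cofinite ideal I in (b) is unique, and ι induces a ring isomorphism P/Ĩ ≅ O₀/I (the induced ring homomorphism P/Ĩ → O₀/I is bijective). -/

import Mathlib

open Filter Topology

noncomputable section

namespace PaleyWiener

/-- The `ℂ`-algebra structure on germs of `ℂ`-valued functions, via constant germs. -/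
instance germAlgebra {α : Type*} {l : Filter α} : Algebra ℂ (Filter.Germ l ℂ) :=
  Algebra.ofModule
    (fun c x y => by
      refine x.inductionOn fun f => y.inductionOn fun g => ?_
      rw [← Filter.Germ.coe_smul, ← Filter.Germ.coe_mul, ← Filter.Germ.coe_mul,
        ← Filter.Germ.coe_smul, smul_mul_assoc])
    (fun c x y => by
      refine x.inductionOn fun f => y.inductionOn fun g => ?_
      rw [← Filter.Germ.coe_smul, ← Filter.Germ.coe_mul, ← Filter.Germ.coe_mul,
        ← Filter.Germ.coe_smul, mul_smul_comm])

variable (n : ℕ)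

/-- The ring of germs at `0` of holomorphic functions on `ℂⁿ`, realized as the subalgebra of
`Filter.Germ (𝓝 0) ℂ` of germs admitting a representative analytic at `0`. -/
def O0 : Subalgebra ℂ (Filter.Germ (𝓝 (0 : Fin n → ℂ)) ℂ) where
  carrier := {g | ∃ f : (Fin n → ℂ) → ℂ, AnalyticAt ℂ f 0 ∧ g = ↑f}
  mul_mem' := by
    rintro a b ⟨f, hf, rfl⟩ ⟨g, hg, rfl⟩
    exact ⟨f * g, hf.mul hg, rfl⟩
  add_mem' := by
    rintro a b ⟨f, hf, rfl⟩ ⟨g, hg, rfl⟩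
    exact ⟨f + g, hf.add hg, rfl⟩
  algebraMap_mem' := fun c => ⟨fun _ => c, analyticAt_const, by
    rw [Algebra.algebraMap_eq_smul_one]
    have h : ((fun _ : Fin n → ℂ => c) : (Fin n → ℂ) → ℂ) = c • (1 : (Fin n → ℂ) → ℂ) := by
      funext x; simp
    rw [h, Filter.Germ.coe_smul, Filter.Germ.coe_one]⟩

/-- Evaluation at `0` of a germ at `𝓝 0`, as a ring homomorphism; this is well defined
since every neighborhood of `0` contains `0`. -/
def germEval0 : Filter.Germ (𝓝 (0 : Fin n → ℂ)) ℂ →+* ℂ where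
  toFun g := g.liftOn (fun f => f 0) fun _ _ h => h.self_of_nhds
  map_one' := rfl
  map_mul' a b := a.inductionOn₂ b fun _ _ => rfl
  map_zero' := rfl
  map_add' a b := a.inductionOn₂ b fun _ _ => rfl

/-- Evaluation at `0` on `O₀`. -/
def evalO0 : O0 n →+* ℂ := (germEval0 n).comp ((O0 n).val : O0 n →ₐ[ℂ] _).toRingHom

/-- The maximal ideal `M` of `O₀`, consisting of the germs vanishing at `0`. -/
def Mideal : Ideal (O0 n) := RingHom.ker (evalO0 n)

end PaleyWiener

namespace PaleyWiener

/-- The germ at `0` of the `i`-th coordinate function on `ℂⁿ`, as an element of `O₀`. -/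
def coordGerm (n : ℕ) (i : Fin n) : O0 n :=
  ⟨(↑(fun x : Fin n → ℂ => x i) : Filter.Germ (nhds (0 : Fin n → ℂ)) ℂ),
    fun x : Fin n → ℂ => x i, by
      have h := (ContinuousLinearMap.proj (R := ℂ) (φ := fun _ : Fin n => ℂ) i).analyticAt
        (0 : Fin n → ℂ)
      exact h, rfl⟩

/-- The `ℂ`-algebra homomorphism `ι : P → O₀` sending a polynomial `p` to the germ at `0`
of its evaluation function on `ℂⁿ` (determined by sending each variable `Xᵢ` to the germ of
the `i`-th coordinate function). -/
def iota (n : ℕ) : MvPolynomial (Fin n) ℂ →ₐ[ℂ] O0 n :=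
  MvPolynomial.aeval (coordGerm n)

end PaleyWiener

namespace PaleyWiener

/-- The ideal `m` of `P = ℂ[x₁,…,xₙ]` of polynomials vanishing at `0`, i.e. with zero
constant coefficient. -/
def mIdeal (n : ℕ) : Ideal (MvPolynomial (Fin n) ℂ) :=
  RingHom.ker (MvPolynomial.constantCoeff (R := ℂ) (σ := Fin n))


section helpers

variable {n : ℕ}

lemma O0_exists_rep (a : O0 n) : ∃ f : (Fin n → ℂ) → ℂ, AnalyticAt ℂ f 0 ∧
    (a : Filter.Germ (𝓝 (0 : Fin n → ℂ)) ℂ) = ↑f := a.2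

/-- The element of `O₀` given by an analytic function. -/
def mkO (f : (Fin n → ℂ) → ℂ) (hf : AnalyticAt ℂ f 0) : O0 n := ⟨(↑f), f, hf, rfl⟩

lemma evalO0_mkO (f : (Fin n → ℂ) → ℂ) (hf : AnalyticAt ℂ f 0) : evalO0 n (mkO f hf) = f 0 := rfl

lemma exists_mkO (a : O0 n) : ∃ f hf, a = mkO f hf := by
  obtain ⟨f, hf, h⟩ := O0_exists_rep a
  exact ⟨f, hf, Subtype.ext h⟩

lemma mkO_eq_iff {f g : (Fin n → ℂ) → ℂ} {hf : AnalyticAt ℂ f 0} {hg : AnalyticAt ℂ g 0} :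
    mkO f hf = mkO g hg ↔ f =ᶠ[𝓝 0] g := by
  rw [Subtype.ext_iff]
  exact Filter.Germ.coe_eq

lemma mkO_mul {f g : (Fin n → ℂ) → ℂ} (hf : AnalyticAt ℂ f 0) (hg : AnalyticAt ℂ g 0) :
    mkO f hf * mkO g hg = mkO (f * g) (hf.mul hg) := rfl

lemma mkO_add {f g : (Fin n → ℂ) → ℂ} (hf : AnalyticAt ℂ f 0) (hg : AnalyticAt ℂ g 0) :
    mkO f hf + mkO g hg = mkO (f + g) (hf.add hg) := rfl

lemma mem_Mideal_mkO {f : (Fin n → ℂ) → ℂ} {hf : AnalyticAt ℂ f 0} :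
    mkO f hf ∈ Mideal n ↔ f 0 = 0 := by
  unfold Mideal
  rw [RingHom.mem_ker, evalO0_mkO]

lemma isUnit_of_eval {a : O0 n} (h : evalO0 n a ≠ 0) : IsUnit a := by
  obtain ⟨f, hf, rfl⟩ := exists_mkO a
  rw [evalO0_mkO] at h
  refine IsUnit.of_mul_eq_one (mkO f⁻¹ (hf.inv h)) ?_
  rw [mkO_mul]
  change _ = mkO (fun _ => 1) analyticAt_const
  rw [mkO_eq_iff]
  filter_upwards [hf.continuousAt.eventually_ne h] with x hx
  simp [hx]

lemma analytic_eval (p : MvPolynomial (Fin n) ℂ) :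
    AnalyticAt ℂ (fun x : Fin n → ℂ => MvPolynomial.eval x p) 0 :=
  AnalyticOnNhd.eval_mvPolynomial p 0 (Set.mem_univ _)

lemma iota_eq (p : MvPolynomial (Fin n) ℂ) :
    iota n p = mkO (fun x => MvPolynomial.eval x p) (analytic_eval p) := by
  induction p using MvPolynomial.induction_on with
  | C a =>
    have h : iota n (MvPolynomial.C a) = algebraMap ℂ (O0 n) a :=
      MvPolynomial.aeval_C _ _
    rw [h]
    apply Subtype.ext
    change algebraMap ℂ (Filter.Germ (𝓝 (0 : Fin n → ℂ)) ℂ) a = _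
    rw [Algebra.algebraMap_eq_smul_one]
    change ((a • (1 : (Fin n → ℂ) → ℂ) : (Fin n → ℂ) → ℂ) : Filter.Germ (𝓝 (0 : Fin n → ℂ)) ℂ) =
      ((fun x => MvPolynomial.eval x (MvPolynomial.C a) : (Fin n → ℂ) → ℂ) :
        Filter.Germ (𝓝 (0 : Fin n → ℂ)) ℂ)
    congr 1
    funext x
    simp
  | add p q hp hq =>
    rw [map_add, hp, hq, mkO_add, mkO_eq_iff]
    exact Eventually.of_forall fun x => by simp
  | mul_X p i hp =>
    have hX : AnalyticAt ℂ (fun x : Fin n → ℂ => x i) 0 :=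
      (ContinuousLinearMap.proj (R := ℂ) (φ := fun _ : Fin n => ℂ) i).analyticAt 0
    have h : iota n (MvPolynomial.X i) = mkO (fun x => x i) hX := MvPolynomial.aeval_X _ _
    rw [map_mul, hp, h, mkO_mul, mkO_eq_iff]
    exact Eventually.of_forall fun x => by simp

lemma eval_iota (p : MvPolynomial (Fin n) ℂ) :
    evalO0 n (iota n p) = MvPolynomial.constantCoeff p := by
  rw [iota_eq, evalO0_mkO, MvPolynomial.eval_zero]

/-- The Hadamard lemma for analytic germs. -/
lemma hadamard {f : (Fin n → ℂ) → ℂ} (hf : AnalyticAt ℂ f 0) (h0 : f 0 = 0) :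
    ∃ G : (Fin n → ℂ) → ((Fin n → ℂ) →L[ℂ] ℂ), AnalyticAt ℂ G 0 ∧
      ∀ᶠ x in 𝓝 0, f x = G x x := by
  obtain ⟨p, r, hp⟩ := hf
  have hr : 0 < p.shift.radius := by
    rw [FormalMultilinearSeries.radius_shift]
    exact hp.r_pos.trans_le hp.r_le
  refine ⟨p.shift.sum, (p.shift.hasFPowerSeriesOnBall hr).analyticAt, ?_⟩
  filter_upwards [Metric.eball_mem_nhds (0 : Fin n → ℂ) hp.r_pos] with x hx
  have hx' : x ∈ Metric.eball (0 : Fin n → ℂ) p.shift.radius := by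
    rw [FormalMultilinearSeries.radius_shift]
    exact Metric.eball_subset_eball hp.r_le hx
  have h1 := (ContinuousLinearMap.apply ℂ ℂ x).hasSum (p.shift.hasSum hx')
  have h2 := hp.hasSum hx
  rw [zero_add, ← hasSum_nat_add_iff' 1] at h2
  have h3 : p 0 (fun _ => x) = 0 := by
    rw [← h0, ← hp.coeff_zero (fun _ => x)]
  simp only [Finset.sum_range_one, h3, sub_zero] at h2
  refine h2.unique ?_
  suffices e : (fun k => p (k + 1) fun _ => x) =
      fun b => ContinuousLinearMap.apply ℂ ℂ x (p.shift b fun _ => x) by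
    rw [e]
    exact h1
  funext k
  simp only [ContinuousLinearMap.apply_apply, FormalMultilinearSeries.shift]
  change _ = (p k.succ).curryRight (fun _ => x) x
  rw [ContinuousMultilinearMap.curryRight_apply]
  congr 1
  funext i
  refine Fin.lastCases ?_ (fun j => ?_) i <;> simp

lemma mIdeal_eq : mIdeal n = MvPolynomial.idealOfVars (Fin n) ℂ := by
  ext p
  rw [← pow_one (MvPolynomial.idealOfVars (Fin n) ℂ), MvPolynomial.mem_pow_idealOfVars_iff',
    mIdeal, RingHom.mem_ker]
  constructor
  · intro h x hx
    have : x = 0 := by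
      rw [← Finsupp.degree_eq_zero_iff]; omega
    rw [this]; exact h
  · intro h
    exact h 0 (by simp)

lemma Mideal_eq_map : Mideal n = (mIdeal n).map (iota n).toRingHom := by
  apply le_antisymm
  · intro a ha
    obtain ⟨f, hf, rfl⟩ := exists_mkO a
    rw [mem_Mideal_mkO] at ha
    obtain ⟨G, hG, h⟩ := hadamard hf ha
    have hg : ∀ i, AnalyticAt ℂ (fun x => G x (Pi.single i 1)) 0 := fun i =>
      ((ContinuousLinearMap.apply ℂ ℂ (Pi.single i (1 : ℂ) : Fin n → ℂ)).analyticAt _).comp hG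
    have key : mkO f hf = ∑ i, mkO _ (hg i) * iota n (MvPolynomial.X i) := by
      simp only [iota_eq, mkO_mul]
      have hs : ∀ s : Finset (Fin n), ∃ hh, ∑ i ∈ s, mkO _ ((hg i).mul (analytic_eval (MvPolynomial.X i))) =
          mkO (fun x => ∑ i ∈ s, G x (Pi.single i 1) * x i) hh := by
        intro s
        induction s using Finset.induction_on with
        | empty => exact ⟨by simpa using analyticAt_const, by simp; rfl⟩
        | insert i s hi ih =>
          obtain ⟨hh, ih⟩ := ih
          rw [Finset.sum_insert hi, ih, mkO_add]
          have e : (((fun x => G x (Pi.single i 1)) * fun x => MvPolynomial.eval x (MvPolynomial.X i)) +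
            fun x => ∑ i ∈ s, G x (Pi.single i 1) * x i) =
            fun x => ∑ i ∈ insert i s, G x (Pi.single i 1) * x i := by
            funext x
            simp [Finset.sum_insert hi]
          refine ⟨e ▸ (((hg i).mul (analytic_eval (MvPolynomial.X i))).add hh), ?_⟩
          rw [mkO_eq_iff, e]
      obtain ⟨hh, hs⟩ := hs Finset.univ
      refine Eq.trans ?_ hs.symm
      rw [mkO_eq_iff]
      filter_upwards [h] with x hx
      rw [hx]
      rw [← ContinuousLinearMap.coe_coe, LinearMap.pi_apply_eq_sum_univ]
      refine Finset.sum_congr rfl fun i _ => ?_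
      rw [smul_eq_mul, mul_comm, ContinuousLinearMap.coe_coe]
      congr 2
      funext j
      simp [Pi.single_apply, eq_comm]
    rw [key]
    refine Ideal.sum_mem _ fun i _ => Ideal.mul_mem_left _ _ (Ideal.mem_map_of_mem _ ?_)
    rw [mIdeal, RingHom.mem_ker, MvPolynomial.constantCoeff_X]
  · rw [Ideal.map_le_iff_le_comap]
    intro p hp
    rw [Ideal.mem_comap, Mideal, RingHom.mem_ker]
    exact (eval_iota p).trans hp

lemma Mideal_pow_eq_map (k : ℕ) : Mideal n ^ k = (mIdeal n ^ k).map (iota n).toRingHom := by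
  rw [Mideal_eq_map, Ideal.map_pow]

lemma bigO_of_mem (k : ℕ) : ∀ a ∈ Mideal n ^ k, ∀ f hf, a = mkO f hf →
    f =O[𝓝 0] fun x => ‖x‖ ^ k := by
  suffices H : ∀ a ∈ Mideal n ^ k, ∃ f hf, a = mkO f hf ∧ f =O[𝓝 0] fun x => ‖x‖ ^ k by
    intro a ha f hf h
    obtain ⟨g, hg, h', hO⟩ := H a ha
    rw [h, mkO_eq_iff] at h'
    exact h'.trans_isBigO hO
  induction k with
  | zero =>
    intro a _
    obtain ⟨f, hf, rfl⟩ := exists_mkO a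
    exact ⟨f, hf, rfl, by simpa using hf.continuousAt.isBigO_one ℝ⟩
  | succ k ih =>
    intro a ha
    rw [pow_succ] at ha
    induction ha using Submodule.mul_induction_on' with
    | mem_mul_mem a ha b hb =>
      obtain ⟨f, hf, rfl, hO⟩ := ih a ha
      obtain ⟨g, hg, rfl⟩ := exists_mkO b
      rw [mem_Mideal_mkO] at hb
      refine ⟨f * g, hf.mul hg, mkO_mul _ _, ?_⟩
      have := hg.differentiableAt.isBigO_sub
      simp only [hb, sub_zero] at this
      simp only [pow_succ]
      exact hO.mul this.norm_right
    | add a _ b _ ha hb =>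
      obtain ⟨f, hf, rfl, hO⟩ := ha
      obtain ⟨g, hg, rfl, hO'⟩ := hb
      exact ⟨f + g, hf.add hg, mkO_add _ _, hO.add hO'⟩

lemma eval_smul_homog {p : MvPolynomial (Fin n) ℂ} {k : ℕ} (hp : p.IsHomogeneous k) (t : ℂ)
    (v : Fin n → ℂ) : MvPolynomial.eval (t • v) p = t ^ k * MvPolynomial.eval v p := by
  rw [MvPolynomial.eval_eq, MvPolynomial.eval_eq, Finset.mul_sum]
  refine Finset.sum_congr rfl fun d hd => ?_
  have hdeg : ∑ i ∈ d.support, d i = k := by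
    have := hp.degree_eq_sum_deg_support hd
    exact this.symm
  simp only [Pi.smul_apply, smul_eq_mul, mul_pow, Finset.prod_mul_distrib, Finset.prod_pow_eq_pow_sum, hdeg]
  ring

lemma iota_mem_pow {k : ℕ} {p : MvPolynomial (Fin n) ℂ} (hp : p ∈ mIdeal n ^ k) :
    iota n p ∈ Mideal n ^ k := by
  rw [Mideal_pow_eq_map]
  exact Ideal.mem_map_of_mem (iota n).toRingHom hp

lemma mem_pow_of_iota_mem (k : ℕ) (p : MvPolynomial (Fin n) ℂ) (h : iota n p ∈ Mideal n ^ k) :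
    p ∈ mIdeal n ^ k := by
  induction k with
  | zero => simp
  | succ k ih =>
    have h1 : p ∈ mIdeal n ^ k := ih (Ideal.pow_le_pow_right (Nat.le_succ k) h)
    set q := MvPolynomial.homogeneousComponent k p with hq
    have hqh : q.IsHomogeneous k := MvPolynomial.homogeneousComponent_isHomogeneous k p
    have h2 : p - q ∈ mIdeal n ^ (k + 1) := by
      rw [mIdeal_eq, MvPolynomial.mem_pow_idealOfVars_iff'] at h1 ⊢
      intro x hx
      rw [MvPolynomial.coeff_sub, hq, MvPolynomial.coeff_homogeneousComponent]
      split_ifs with hk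
      · simp
      · rw [h1 x (by omega), sub_zero]
    have h3 : iota n q ∈ Mideal n ^ (k + 1) := by
      have := Ideal.sub_mem _ h (iota_mem_pow h2)
      rwa [← map_sub, sub_sub_cancel] at this
    have h4 := bigO_of_mem _ _ h3 _ _ (iota_eq q)
    have h5 : q = 0 := by
      apply MvPolynomial.funext
      intro v
      rw [map_zero]
      have ht : Tendsto (fun t : ℂ => t • v) (𝓝[≠] 0) (𝓝 0) := by
        have : Tendsto (fun t : ℂ => t • v) (𝓝 0) (𝓝 ((0 : ℂ) • v)) := by
          exact (continuous_id.smul continuous_const).tendsto 0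
        rw [zero_smul] at this
        exact this.mono_left nhdsWithin_le_nhds
      have h6 := h4.comp_tendsto ht
      obtain ⟨C, hC⟩ := h6.bound
      have h7 : ∀ᶠ t : ℂ in 𝓝[≠] 0, ‖MvPolynomial.eval v q‖ ≤ C * (‖t‖ * ‖v‖ ^ (k + 1)) := by
        filter_upwards [hC, self_mem_nhdsWithin] with t ht ht0
        have ht0 : 0 < ‖t‖ := norm_pos_iff.2 ht0
        simp only [Function.comp, eval_smul_homog hqh, norm_mul, norm_pow, norm_smul, norm_norm] at ht
        have hpos : 0 < ‖t‖ ^ k := by positivity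
        refine le_of_mul_le_mul_left (ht.trans_eq ?_) hpos
        ring
      have h8 : Tendsto (fun t : ℂ => C * (‖t‖ * ‖v‖ ^ (k + 1))) (𝓝[≠] 0) (𝓝 0) := by
        have : Continuous (fun t : ℂ => C * (‖t‖ * ‖v‖ ^ (k + 1))) := by fun_prop
        have := this.tendsto 0
        simp only [norm_zero, zero_mul, mul_zero] at this
        exact this.mono_left nhdsWithin_le_nhds
      have h9 := ge_of_tendsto h8 h7
      exact norm_le_zero_iff.1 h9
    rwa [h5, sub_zero] at h2

lemma approx_step (J : Ideal (MvPolynomial (Fin n) ℂ)) (a : O0 n)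
    (ha : a ∈ J.map (iota n).toRingHom) :
    ∃ p ∈ J, a - iota n p ∈ Mideal n * J.map (iota n).toRingHom := by
  rw [Ideal.map] at ha
  induction ha using Submodule.span_induction with
  | mem x hx =>
    obtain ⟨p, hp, rfl⟩ := hx
    exact ⟨p, hp, by
      change iota n p - iota n p ∈ _
      rw [sub_self]; exact Ideal.zero_mem _⟩
  | zero => exact ⟨0, J.zero_mem, by rw [map_zero, sub_zero]; exact Ideal.zero_mem _⟩
  | add x y _ _ hx hy =>
    obtain ⟨p, hp, hx⟩ := hx
    obtain ⟨q, hq, hy⟩ := hy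
    refine ⟨p + q, J.add_mem hp hq, ?_⟩
    have e : x + y - iota n (p + q) = (x - iota n p) + (y - iota n q) := by
      rw [map_add]; ring
    rw [e]; exact Ideal.add_mem _ hx hy
  | smul b x hxm hx =>
    obtain ⟨p, hp, hx⟩ := hx
    refine ⟨MvPolynomial.C (evalO0 n b) * p, J.mul_mem_left _ hp, ?_⟩
    have e : b • x - iota n (MvPolynomial.C (evalO0 n b) * p) =
        (b - iota n (MvPolynomial.C (evalO0 n b))) * x +
          iota n (MvPolynomial.C (evalO0 n b)) * (x - iota n p) := by
      rw [map_mul, smul_eq_mul]; ring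
    rw [e]
    refine Ideal.add_mem _ (Ideal.mul_mem_mul ?_ hxm) (Ideal.mul_mem_left _ _ hx)
    rw [Mideal, RingHom.mem_ker, map_sub, eval_iota, MvPolynomial.constantCoeff_C, sub_self]

lemma approx (k : ℕ) (a : O0 n) : ∃ p, a - iota n p ∈ Mideal n ^ k := by
  induction k with
  | zero => exact ⟨0, by rw [pow_zero, Ideal.one_eq_top]; trivial⟩
  | succ k ih =>
    obtain ⟨p, hp⟩ := ih
    rw [Mideal_pow_eq_map] at hp
    obtain ⟨q, _, h⟩ := approx_step _ _ hp
    rw [← Mideal_pow_eq_map, ← pow_succ'] at h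
    exact ⟨p + q, by rwa [map_add, ← sub_sub]⟩

lemma approx_mem (k : ℕ) (J : Ideal (MvPolynomial (Fin n) ℂ)) (a : O0 n)
    (ha : a ∈ J.map (iota n).toRingHom) :
    ∃ p ∈ J, a - iota n p ∈ Mideal n ^ k := by
  rw [Ideal.map] at ha
  induction ha using Submodule.span_induction with
  | mem x hx =>
    obtain ⟨p, hp, rfl⟩ := hx
    exact ⟨p, hp, by
      change iota n p - iota n p ∈ _
      rw [sub_self]; exact Ideal.zero_mem _⟩
  | zero => exact ⟨0, J.zero_mem, by rw [map_zero, sub_zero]; exact Ideal.zero_mem _⟩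
  | add x y _ _ hx hy =>
    obtain ⟨p, hp, hx⟩ := hx
    obtain ⟨q, hq, hy⟩ := hy
    refine ⟨p + q, J.add_mem hp hq, ?_⟩
    have e : x + y - iota n (p + q) = (x - iota n p) + (y - iota n q) := by
      rw [map_add]; ring
    rw [e]; exact Ideal.add_mem _ hx hy
  | smul b x hxm hx =>
    obtain ⟨p, hp, hx⟩ := hx
    obtain ⟨r, hr⟩ := approx k b
    refine ⟨r * p, J.mul_mem_left _ hp, ?_⟩
    have e : b • x - iota n (r * p) = x * (b - iota n r) + iota n r * (x - iota n p) := by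
      rw [map_mul, smul_eq_mul]; ring
    rw [e]
    exact Ideal.add_mem _ (Ideal.mul_mem_left _ _ hr) (Ideal.mul_mem_left _ _ hx)

lemma exists_pow_le_gen {A : Type*} [CommRing A] [Algebra ℂ A] (M I : Ideal A)
    (hM : ∀ a ∈ M, ∀ b, IsUnit (a * b + 1)) (hI : Module.Finite ℂ (A ⧸ I)) :
    ∃ k : ℕ, M ^ k ≤ I := by
  have : IsArtinianRing (A ⧸ I) := IsArtinianRing.of_finite ℂ _
  obtain ⟨k, hk⟩ := IsArtinianRing.isNilpotent_jacobson_bot (R := A ⧸ I)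
  refine ⟨k, ?_⟩
  have hle : M.map (Ideal.Quotient.mk I) ≤ Ideal.jacobson ⊥ := by
    rw [Ideal.map_le_iff_le_comap]
    intro a ha
    rw [Ideal.mem_comap]
    refine Ideal.mem_jacobson_bot.2 ?_
    intro y
    obtain ⟨b, rfl⟩ := Ideal.Quotient.mk_surjective y
    rw [← map_mul, ← map_one (Ideal.Quotient.mk I), ← map_add]
    exact IsUnit.map _ (hM a ha b)
  have h2 : (M ^ k).map (Ideal.Quotient.mk I) ≤ ⊥ := by
    rw [Ideal.map_pow]
    exact (Ideal.pow_right_mono hle k).trans_eq hk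
  rw [le_bot_iff, Ideal.map_eq_bot_iff_le_ker, Ideal.mk_ker] at h2
  exact h2

lemma exists_pow_le (I : Ideal (O0 n)) (hI : FiniteDimensional ℂ (O0 n ⧸ I)) :
    ∃ k : ℕ, Mideal n ^ k ≤ I := by
  refine exists_pow_le_gen (Mideal n) I (fun a ha b => isUnit_of_eval ?_) hI
  rw [Mideal, RingHom.mem_ker] at ha
  rw [map_add, map_mul, ha, zero_mul, map_one, zero_add]
  exact one_ne_zero

lemma finite_of_pow_le (k : ℕ) (I : Ideal (O0 n)) (hI : Mideal n ^ k ≤ I) :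
    FiniteDimensional ℂ (O0 n ⧸ I) := by
  let L : MvPolynomial.restrictTotalDegree (Fin n) ℂ k →ₗ[ℂ] (O0 n ⧸ I) :=
    ((Ideal.Quotient.mkₐ ℂ I).toLinearMap.comp (iota n).toLinearMap).comp (Submodule.subtype _)
  refine Module.Finite.of_surjective L ?_
  intro y
  obtain ⟨a, rfl⟩ := Ideal.Quotient.mk_surjective y
  obtain ⟨p, hp⟩ := approx k a
  let q := ∑ i ∈ Finset.range k, MvPolynomial.homogeneousComponent i p
  have hq : q ∈ MvPolynomial.restrictTotalDegree (Fin n) ℂ k := by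
    refine Submodule.sum_mem _ fun i hi => ?_
    rw [MvPolynomial.mem_restrictTotalDegree]
    exact (MvPolynomial.homogeneousComponent_isHomogeneous i p).totalDegree_le.trans
      (Finset.mem_range.1 hi).le
  have hpq : p - q ∈ mIdeal n ^ k := by
    rw [mIdeal_eq, MvPolynomial.mem_pow_idealOfVars_iff']
    intro x hx
    simp only [q, MvPolynomial.coeff_sub, MvPolynomial.coeff_sum,
      MvPolynomial.coeff_homogeneousComponent]
    simp [hx]
  refine ⟨⟨q, hq⟩, ?_⟩
  change Ideal.Quotient.mk I (iota n q) = Ideal.Quotient.mk I a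
  rw [eq_comm, Ideal.Quotient.eq]
  apply hI
  have := Ideal.add_mem _ hp (iota_mem_pow hpq)
  rwa [map_sub, sub_add_sub_cancel] at this

lemma uniq_aux {k : ℕ} {I₁ I₂ : Ideal (O0 n)} (h1 : Mideal n ^ k ≤ I₁) (h2 : Mideal n ^ k ≤ I₂)
    (h : I₁.comap (iota n).toRingHom = I₂.comap (iota n).toRingHom) : I₁ ≤ I₂ := by
  intro a ha
  obtain ⟨p, hp⟩ := approx k a
  have h3 : p ∈ I₁.comap (iota n).toRingHom := by
    have := Ideal.sub_mem _ ha (h1 hp)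
    rw [sub_sub_cancel] at this
    exact this
  rw [h] at h3
  have h4 : iota n p ∈ I₂ := h3
  have := Ideal.add_mem _ (h2 hp) h4
  rwa [sub_add_cancel] at this

end helpers

set_option synthInstance.maxHeartbeats 1000000 in
/-- For an ideal `Ĩ` of `P`, the following are equivalent:
(a) `m^(k+1) ⊆ Ĩ` for some `k`; (b) `Ĩ = ι⁻¹(I)` for some cofinite ideal `I` of `O₀`.
Moreover the cofinite ideal `I` in (b) is unique, and `ι` induces a ring isomorphism
`P/Ĩ ≅ O₀/I` (the induced ring homomorphism `P/Ĩ → O₀/I` is bijective). -/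
theorem polynomial_ideal_extension (n : ℕ) (hn : 1 ≤ n)
    (Itilde : Ideal (MvPolynomial (Fin n) ℂ)) :
    ((∃ k : ℕ, (mIdeal n) ^ (k + 1) ≤ Itilde) ↔
      (∃ I : Ideal (O0 n), FiniteDimensional ℂ (O0 n ⧸ I) ∧
        Itilde = I.comap (iota n).toRingHom)) ∧
    (∀ I₁ I₂ : Ideal (O0 n), FiniteDimensional ℂ (O0 n ⧸ I₁) →
      FiniteDimensional ℂ (O0 n ⧸ I₂) → Itilde = I₁.comap (iota n).toRingHom →
      Itilde = I₂.comap (iota n).toRingHom → I₁ = I₂) ∧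
    (∀ I : Ideal (O0 n), FiniteDimensional ℂ (O0 n ⧸ I) →
      ∀ h : Itilde = I.comap (iota n).toRingHom,
        Function.Bijective (Ideal.quotientMap I (iota n).toRingHom (le_of_eq h))) := by
  refine ⟨⟨?_, ?_⟩, ?_, ?_⟩
  · rintro ⟨k, hk⟩
    have hM : Mideal n ^ (k + 1) ≤ Itilde.map (iota n).toRingHom := by
      rw [Mideal_pow_eq_map]
      exact Ideal.map_mono hk
    refine ⟨Itilde.map (iota n).toRingHom, finite_of_pow_le (k + 1) _ hM, ?_⟩
    refine le_antisymm Ideal.le_comap_map ?_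
    intro p hp
    obtain ⟨q, hq, h⟩ := approx_mem (k + 1) Itilde (iota n p) hp
    rw [← map_sub] at h
    have := Itilde.add_mem (hk (mem_pow_of_iota_mem _ _ h)) hq
    rwa [sub_add_cancel] at this
  · rintro ⟨I, hI, rfl⟩
    obtain ⟨k, hk⟩ := exists_pow_le I hI
    refine ⟨k, fun p hp => hk ?_⟩
    exact iota_mem_pow (Ideal.pow_le_pow_right (Nat.le_succ k) hp)
  · intro I₁ I₂ hI₁ hI₂ h1 h2
    obtain ⟨k, hk⟩ := exists_pow_le I₁ hI₁
    obtain ⟨l, hl⟩ := exists_pow_le I₂ hI₂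
    have hk' := (Ideal.pow_le_pow_right (I := Mideal n) (le_max_left k l)).trans hk
    have hl' := (Ideal.pow_le_pow_right (I := Mideal n) (le_max_right k l)).trans hl
    exact le_antisymm (uniq_aux hk' hl' (h1.symm.trans h2)) (uniq_aux hl' hk' (h2.symm.trans h1))
  · intro I hI h
    refine ⟨Ideal.quotientMap_injective' (le_of_eq h.symm), ?_⟩
    intro y
    obtain ⟨a, rfl⟩ := Ideal.Quotient.mk_surjective y
    obtain ⟨k, hk⟩ := exists_pow_le I hI
    obtain ⟨p, hp⟩ := approx k a
    refine ⟨Ideal.Quotient.mk _ p, ?_⟩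
    rw [Ideal.quotientMap_mk, eq_comm, Ideal.Quotient.eq]
    exact hk hp

end PaleyWiener
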